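/- arXiv:2003.09618 — 10 statements merged into one kernel-verified Lean document; each statement's English description precedes it below -/
import Mathlib

section
/- Let γ ∈ ℂ with 0 < |γ| ≤ 1 and γ ≠ −1. Then (|γ| + 1)/|γ + 1| ≤ √5 · max(1, √|γ| / |γ + 1|). -/
/-- the key scalar inequality of Section 2:
`(|γ| + 1)/|γ + 1| ≤ √5 · max(1, √|γ| / |γ + 1|)` for `0 < |γ| ≤ 1`, `γ ≠ −1`. -/
theorem quadratic_key_scalar_inequality
    (γ : ℂ) (h1 : 0 < ‖γ‖) (h2 : ‖γ‖ ≤ 1) (h3 : γ ≠ -1) :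
    (‖γ‖ + 1) / ‖γ + 1‖ ≤ Real.sqrt 5 * max 1 (Real.sqrt ‖γ‖ / ‖γ + 1‖) := by
  have hs : 0 < ‖γ + 1‖ := norm_pos_iff.mpr fun h => h3 (eq_neg_of_add_eq_zero_left h)
  have htri : 1 - ‖γ‖ ≤ ‖γ + 1‖ := by
    simpa [add_comm] using norm_sub_norm_le (1 : ℂ) (-γ)
  have hsq : (‖γ‖ + 1) ^ 2 ≤ ‖γ + 1‖ ^ 2 + 4 * ‖γ‖ := by nlinarith
  rw [div_le_iff₀ hs, mul_assoc, max_mul_of_nonneg _ _ hs.le, one_mul, div_mul_cancel₀ _ hs.ne']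
  refine abs_le_of_sq_le_sq' ?_ (by positivity) |>.2
  rw [mul_pow, Real.sq_sqrt (by norm_num)]
  have hmax₁ : ‖γ + 1‖ ^ 2 ≤ max ‖γ + 1‖ (Real.sqrt ‖γ‖) ^ 2 := by
    gcongr
    exact le_max_left _ _
  have hmax₂ : ‖γ‖ ≤ max ‖γ + 1‖ (Real.sqrt ‖γ‖) ^ 2 :=
    Real.sqrt_le_left (by positivity) |>.mp (le_max_right _ _)
  linarith
end

section
/- Let a, b, c ∈ ℂ be nonzero, let x₁, x₂ ∈ ℂ \ {0} be such that ax² + bx + c = a(x − x₁)(x − x₂), and let ε ≥ 0, K ≥ 0. Suppose x̃₁, x̃₂, x̂₁, x̂₂ ∈ ℂ satisfy |x̂ᵢ − x̃ᵢ| ≤ ε|x̃ᵢ| and |x̃ᵢ| ≤ K|xᵢ| for i = 1, 2, and |b + a(x̃₁ + x̃₂)| ≤ ε|b|. Then, with r_b = max(1, √(|a||c|)/|b|), one has |b + a(x̂₁ + x̂₂)| ≤ ε·(1 + √5·K)·r_b·|b|. -/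
/-- The sum of the moduli of two complex numbers, in terms of their sum and product. -/
theorem Complex.norm_add_norm_sq_le (x y : ℂ) :
    (‖x‖ + ‖y‖) ^ 2 ≤ ‖x + y‖ ^ 2 + 4 * ‖x * y‖ := by
  have hpar := parallelogram_law_with_norm ℝ x y
  have hdiff : ‖x - y‖ ^ 2 ≤ ‖x + y‖ ^ 2 + 4 * ‖x * y‖ := by
    calc ‖x - y‖ ^ 2 = ‖(x + y) ^ 2 - 4 * (x * y)‖ := by
          rw [← norm_pow]
          congr 1
          ring
      _ ≤ ‖(x + y) ^ 2‖ + ‖4 * (x * y)‖ := norm_sub_le _ _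
      _ = ‖x + y‖ ^ 2 + 4 * ‖x * y‖ := by
          rw [norm_pow, norm_mul 4, Complex.norm_ofNat]
  rw [norm_mul] at hdiff ⊢
  nlinarith

/-- forward direction of Proposition 2.1 (EMBE implies TBE for quadratics),
with `r_b = max(1, √(|a||c|)/|b|)` the tropical scaling constant. -/
theorem quadratic_EMBE_implies_TBE
    (a b c : ℂ) (ha : a ≠ 0) (hb : b ≠ 0) (hc : c ≠ 0)
    (x1 x2 : ℂ) (hx1 : x1 ≠ 0) (hx2 : x2 ≠ 0)
    (hf : ∀ x : ℂ, a * x ^ 2 + b * x + c = a * (x - x1) * (x - x2))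
    (ε K : ℝ) (hε : 0 ≤ ε) (hK : 0 ≤ K)
    (xt1 xt2 xh1 xh2 : ℂ)
    (h1 : ‖xh1 - xt1‖ ≤ ε * ‖xt1‖)
    (h2 : ‖xh2 - xt2‖ ≤ ε * ‖xt2‖)
    (h1' : ‖xt1‖ ≤ K * ‖x1‖)
    (h2' : ‖xt2‖ ≤ K * ‖x2‖)
    (h3 : ‖b + a * (xt1 + xt2)‖ ≤ ε * ‖b‖) :
    ‖b + a * (xh1 + xh2)‖ ≤
      ε * (1 + Real.sqrt 5 * K) * max 1 (Real.sqrt (‖a‖ * ‖c‖) / ‖b‖) * ‖b‖ := by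
  have hcoef_c : c = a * (x1 * x2) := by linear_combination hf 0
  have hcoef_b : b = -(a * (x1 + x2)) := by
    linear_combination (hf 1 - hf (-1)) / 2
  have hb_pos : 0 < ‖b‖ := norm_pos_iff.mpr hb
  rw [mul_assoc, max_mul_of_nonneg _ _ hb_pos.le, one_mul, div_mul_cancel₀ _ hb_pos.ne']
  set M := max ‖b‖ (√(‖a‖ * ‖c‖))
  have hbM : ‖b‖ ≤ M := le_max_left _ _
  have hM_nonneg : 0 ≤ M := hb_pos.le.trans hbM
  have hacM : ‖a‖ * ‖c‖ ≤ M ^ 2 := (Real.sqrt_le_left hM_nonneg).mp (le_max_right _ _)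
  have hroots : ‖a‖ * (‖x1‖ + ‖x2‖) ≤ √5 * M := by
    refine (pow_le_pow_iff_left₀ (by positivity) (by positivity) two_ne_zero).mp ?_
    have hnorm_b : ‖b‖ = ‖a‖ * ‖x1 + x2‖ := by rw [hcoef_b, norm_neg, norm_mul]
    have hnorm_c : ‖c‖ = ‖a‖ * ‖x1 * x2‖ := by rw [hcoef_c, norm_mul]
    calc (‖a‖ * (‖x1‖ + ‖x2‖)) ^ 2 = ‖a‖ ^ 2 * (‖x1‖ + ‖x2‖) ^ 2 := mul_pow _ _ _
      _ ≤ ‖a‖ ^ 2 * (‖x1 + x2‖ ^ 2 + 4 * ‖x1 * x2‖) := by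
          gcongr
          exact Complex.norm_add_norm_sq_le x1 x2
      _ = ‖b‖ ^ 2 + 4 * (‖a‖ * ‖c‖) := by rw [hnorm_b, hnorm_c]; ring
      _ ≤ M ^ 2 + 4 * M ^ 2 := by gcongr
      _ = (√5 * M) ^ 2 := by rw [mul_pow, Real.sq_sqrt (by norm_num)]; ring
  calc ‖b + a * (xh1 + xh2)‖
      = ‖(b + a * (xt1 + xt2)) + a * ((xh1 - xt1) + (xh2 - xt2))‖ := by
        congr 1
        ring
    _ ≤ ‖b + a * (xt1 + xt2)‖ + ‖a‖ * (‖xh1 - xt1‖ + ‖xh2 - xt2‖) := by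
        refine (norm_add_le _ _).trans ?_
        rw [norm_mul]
        gcongr
        exact norm_add_le _ _
    _ ≤ ε * ‖b‖ + ‖a‖ * (ε * (K * ‖x1‖) + ε * (K * ‖x2‖)) := by
        gcongr
        · exact h1.trans (by gcongr)
        · exact h2.trans (by gcongr)
    _ = ε * ‖b‖ + ε * K * (‖a‖ * (‖x1‖ + ‖x2‖)) := by ring
    _ ≤ ε * M + ε * K * (√5 * M) := by gcongr
    _ = ε * (1 + √5 * K) * M := by ring
end

section
/- Let a, b, c ∈ ℂ with a ≠ 0 and b ≠ 0, and set r_b = √(|a||c|)/|b|. Let x̂₁, x̂₂, δ ∈ ℂ satisfy a(x̂₁ + x̂₂) = −b(1 + r_b·δ). Define x̃₁ = x̂₁ + (b/a)·r_b·δ and x̃₂ = x̂₂. Then: (i) a(x̃₁ + x̃₂) = −b; (ii) |x̃₁ − x̂₁| = √(|c|/|a|)·|δ|; and (iii) |a·x̃₁·x̃₂ − a·x̂₁·x̂₂| = √(|a||c|)·|δ|·|x̂₂|. -/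
/-- the explicit construction in Section 2 showing TBE implies EMBE for
quadratics in the case `r_b = √(|a||c|)/|b|`. -/
theorem quadratic_TBE_implies_EMBE_construction
    (a b c : ℂ) (ha : a ≠ 0) (hb : b ≠ 0)
    (xh1 xh2 δ : ℂ)
    (rb : ℝ) (hrb : rb = Real.sqrt (‖a‖ * ‖c‖) / ‖b‖)
    (h : a * (xh1 + xh2) = -b * (1 + (rb : ℂ) * δ)) :
    a * ((xh1 + (b / a) * (rb : ℂ) * δ) + xh2) = -b ∧
    ‖(xh1 + (b / a) * (rb : ℂ) * δ) - xh1‖ = Real.sqrt (‖c‖ / ‖a‖) * ‖δ‖ ∧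
    ‖a * (xh1 + (b / a) * (rb : ℂ) * δ) * xh2 - a * xh1 * xh2‖ =
      Real.sqrt (‖a‖ * ‖c‖) * ‖δ‖ * ‖xh2‖ := by
  have hna : ‖a‖ ≠ 0 := norm_ne_zero_iff.mpr ha
  have hnb : ‖b‖ ≠ 0 := norm_ne_zero_iff.mpr hb
  have hrb_nonneg : 0 ≤ rb := by rw [hrb]; positivity
  have hrb_norm : ‖(rb : ℂ)‖ = rb := Complex.norm_of_nonneg hrb_nonneg
  have hb_rb : ‖b‖ * rb = Real.sqrt (‖a‖ * ‖c‖) := by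
    rw [hrb]; field_simp
  have hsqrt : Real.sqrt (‖a‖ * ‖c‖) = ‖a‖ * Real.sqrt (‖c‖ / ‖a‖) := by
    have hprod : ‖a‖ * ‖c‖ = ‖a‖ ^ 2 * (‖c‖ / ‖a‖) := by field_simp
    rw [hprod, Real.sqrt_mul (sq_nonneg _), Real.sqrt_sq (norm_nonneg a)]
  have hcancel : a * (b / a) = b := mul_div_cancel₀ b ha
  refine ⟨?_, ?_, ?_⟩
  · linear_combination h + (rb : ℂ) * δ * hcancel
  · rw [add_sub_cancel_left, norm_mul, norm_mul, norm_div, hrb_norm, div_mul_eq_mul_div,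
      hb_rb, hsqrt, mul_div_cancel_left₀ _ hna]
  · have hdiff : a * (xh1 + (b / a) * (rb : ℂ) * δ) * xh2 - a * xh1 * xh2 =
        b * (rb : ℂ) * δ * xh2 := by
      linear_combination (rb : ℂ) * δ * xh2 * hcancel
    rw [hdiff, norm_mul, norm_mul, norm_mul, hrb_norm, hb_rb]
end

section
/- Let d ≥ 1, ε ≥ 0, and let x̃ = (x̃₁, …, x̃_d), x̂ = (x̂₁, …, x̂_d) ∈ ℂ^d satisfy |x̂_j − x̃_j| ≤ ε|x̃_j| for j = 1, …, d. Then for every k with 0 ≤ k ≤ d, |σ_k(x̂₁, …, x̂_d) − σ_k(x̃₁, …, x̃_d)| ≤ ((1 + ε)^k − 1)·σ_k(|x̃₁|, …, |x̃_d|). -/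
/-- The `k`-th elementary symmetric polynomial
`σ_k(x₁, …, x_d) = Σ_{|I| = k} ∏_{j ∈ I} x_j`. -/
def esymm {R : Type*} [CommSemiring R] (d k : ℕ) (x : Fin d → R) : R :=
  ∑ I ∈ Finset.powersetCard k (Finset.univ : Finset (Fin d)), ∏ j ∈ I, x j

/-- A product of factors perturbed with relative error at most `ε` has relative error at most
`(1 + ε) ^ n - 1`, where `n` is the number of factors. -/
theorem norm_prod_sub_prod_le_of_relative_error {ι 𝕜 : Type*} [NormedField 𝕜] {ε : ℝ}
    (hε : 0 ≤ ε) {x y : ι → 𝕜} (s : Finset ι) (h : ∀ j ∈ s, ‖y j - x j‖ ≤ ε * ‖x j‖) :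
    ‖∏ j ∈ s, y j - ∏ j ∈ s, x j‖ ≤ ((1 + ε) ^ s.card - 1) * ∏ j ∈ s, ‖x j‖ := by
  classical
  induction s using Finset.induction_on with
  | empty => simp
  | insert a s ha ih =>
    have ih := ih fun j hj => h j (Finset.mem_insert_of_mem hj)
    have hsub := h a (Finset.mem_insert_self a s)
    have hy : ‖y a‖ ≤ (1 + ε) * ‖x a‖ := by
      linarith [norm_sub_norm_le (y a) (x a)]
    rw [Finset.prod_insert ha, Finset.prod_insert ha, Finset.prod_insert ha,
      Finset.card_insert_of_notMem ha]
    calc ‖y a * ∏ j ∈ s, y j - x a * ∏ j ∈ s, x j‖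
        = ‖y a * (∏ j ∈ s, y j - ∏ j ∈ s, x j) + (y a - x a) * ∏ j ∈ s, x j‖ := by
          congr 1; ring
      _ ≤ ‖y a‖ * ‖∏ j ∈ s, y j - ∏ j ∈ s, x j‖ + ‖y a - x a‖ * ∏ j ∈ s, ‖x j‖ := by
          simpa only [norm_mul, norm_prod] using
            norm_add_le (y a * (∏ j ∈ s, y j - ∏ j ∈ s, x j)) ((y a - x a) * ∏ j ∈ s, x j)
      _ ≤ ((1 + ε) * ‖x a‖) * (((1 + ε) ^ s.card - 1) * ∏ j ∈ s, ‖x j‖) +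
            (ε * ‖x a‖) * ∏ j ∈ s, ‖x j‖ := by gcongr
      _ = ((1 + ε) ^ (s.card + 1) - 1) * (‖x a‖ * ∏ j ∈ s, ‖x j‖) := by ring

/-- perturbation estimate for elementary symmetric polynomials
(the estimate underlying Lemma 3.2 of the paper). -/
theorem esymm_perturbation_bound
    (d : ℕ) (hd : 1 ≤ d) (ε : ℝ) (hε : 0 ≤ ε)
    (xt xh : Fin d → ℂ)
    (h : ∀ j, ‖xh j - xt j‖ ≤ ε * ‖xt j‖)
    (k : ℕ) (hk : k ≤ d) :
    ‖esymm d k xh - esymm d k xt‖ ≤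
      ((1 + ε) ^ k - 1) * esymm d k (fun j => ‖xt j‖) := by
  unfold esymm
  rw [← Finset.sum_sub_distrib, Finset.mul_sum]
  refine norm_sum_le_of_le _ fun I hI => ?_
  rw [← (Finset.mem_powersetCard.mp hI).2]
  exact norm_prod_sub_prod_le_of_relative_error hε I fun j _ => h j
end

section
/- Let d ≥ 1, ε ≥ 0, c_d ∈ ℂ \ {0}, and let c₀, …, c_{d−1} ∈ ℂ. Let x̃ = (x̃₁, …, x̃_d), x̂ = (x̂₁, …, x̂_d) ∈ ℂ^d satisfy |x̂_j − x̃_j| ≤ ε|x̃_j| for j = 1, …, d, and let c̃_i and ĉ_i denote the degree-i coefficients of c_d·∏_{j=1}^d (X − x̃_j) and c_d·∏_{j=1}^d (X − x̂_j) respectively. If |c_i − c̃_i| ≤ ε|c_i| for some i ∈ {0, …, d−1}, then |ĉ_i − c_i| ≤ ε·|c_i| + ((1 + ε)^{d−i} − 1)·|c_d|·σ_{d−i}(|x̃₁|, …, |x̃_d|). -/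
open Polynomial

/-- A relative perturbation of size `ε` in each factor perturbs a product of `n` factors by a
relative amount of at most `(1 + ε) ^ n - 1`. -/
theorem norm_prod_sub_prod_le {ι 𝕜 : Type*} [NormedField 𝕜] (s : Finset ι) {ε : ℝ} (hε : 0 ≤ ε)
    {a b : ι → 𝕜} (h : ∀ j ∈ s, ‖b j - a j‖ ≤ ε * ‖a j‖) :
    ‖∏ j ∈ s, b j - ∏ j ∈ s, a j‖ ≤ ((1 + ε) ^ s.card - 1) * ∏ j ∈ s, ‖a j‖ := by
  classical
  induction s using Finset.induction_on with
  | empty => simp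
  | insert j s hj ih =>
    rw [Finset.prod_insert hj, Finset.prod_insert hj, Finset.prod_insert hj,
      Finset.card_insert_of_notMem hj]
    have hs := ih fun k hk => h k (Finset.mem_insert_of_mem hk)
    have hd := h j (Finset.mem_insert_self j s)
    have hb : ‖b j‖ ≤ (1 + ε) * ‖a j‖ := by
      linarith [norm_le_norm_add_norm_sub (a j) (b j), norm_sub_rev (a j) (b j)]
    calc ‖b j * ∏ k ∈ s, b k - a j * ∏ k ∈ s, a k‖
        = ‖b j * (∏ k ∈ s, b k - ∏ k ∈ s, a k) + (b j - a j) * ∏ k ∈ s, a k‖ := by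
          congr 1; ring
      _ ≤ ‖b j‖ * ‖∏ k ∈ s, b k - ∏ k ∈ s, a k‖ + ‖b j - a j‖ * ∏ k ∈ s, ‖a k‖ := by
          rw [← norm_prod, ← norm_mul, ← norm_mul]
          exact norm_add_le _ _
      _ ≤ (1 + ε) * ‖a j‖ * (((1 + ε) ^ s.card - 1) * ∏ k ∈ s, ‖a k‖)
            + ε * ‖a j‖ * ∏ k ∈ s, ‖a k‖ := by
          gcongr
      _ = ((1 + ε) ^ (s.card + 1) - 1) * (‖a j‖ * ∏ k ∈ s, ‖a k‖) := by ring

theorem norm_esymm_sub_esymm_le {𝕜 : Type*} [NormedField 𝕜] (d k : ℕ) {ε : ℝ} (hε : 0 ≤ ε)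
    {a b : Fin d → 𝕜} (h : ∀ j, ‖b j - a j‖ ≤ ε * ‖a j‖) :
    ‖esymm d k b - esymm d k a‖ ≤ ((1 + ε) ^ k - 1) * esymm d k (fun j => ‖a j‖) := by
  unfold esymm
  rw [← Finset.sum_sub_distrib, Finset.mul_sum]
  refine norm_sum_le_of_le _ fun I hI => ?_
  rw [← (Finset.mem_powersetCard.mp hI).2]
  exact norm_prod_sub_prod_le I hε fun j _ => h j

theorem coeff_C_mul_prod_X_sub_C {R : Type*} [CommRing R] {d i : ℕ} (hi : i ≤ d) (r : R)
    (x : Fin d → R) :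
    (C r * ∏ j : Fin d, (X - C (x j))).coeff i = r * ((-1) ^ (d - i) * esymm d (d - i) x) := by
  have hcoeff := Finset.prod_X_add_C_coeff (Finset.univ : Finset (Fin d)) (fun j => -x j)
    (k := i) (by simpa using hi)
  simp only [C_neg, ← sub_eq_add_neg, Finset.card_univ, Fintype.card_fin] at hcoeff
  rw [coeff_C_mul, hcoeff, esymm]
  congr 1
  rw [Finset.mul_sum]
  refine Finset.sum_congr rfl fun I hI => ?_
  rw [Finset.prod_neg, (Finset.mem_powersetCard.mp hI).2]

/-- Lemma 3.2 of the paper.  If `|x̂_j − x̃_j| ≤ ε |x̃_j|` and the degree-`i`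
coefficient `c̃_i` of `c_d ∏ (X − x̃_j)` satisfies `|c_i − c̃_i| ≤ ε |c_i|`, then the
degree-`i` coefficient `ĉ_i` of `c_d ∏ (X − x̂_j)` satisfies
`|ĉ_i − c_i| ≤ ε |c_i| + ((1+ε)^{d−i} − 1) |c_d| σ_{d−i}(|x̃₁|, …, |x̃_d|)`. -/
theorem coefficient_perturbation_bound
    (d : ℕ) (hd : 1 ≤ d) (ε : ℝ) (hε : 0 ≤ ε)
    (cd : ℂ) (hcd : cd ≠ 0) (c : ℕ → ℂ)
    (xt xh : Fin d → ℂ)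
    (h : ∀ j, ‖xh j - xt j‖ ≤ ε * ‖xt j‖)
    (i : ℕ) (hi : i < d)
    (hci : ‖c i - (C cd * ∏ j : Fin d, (X - C (xt j))).coeff i‖ ≤ ε * ‖c i‖) :
    ‖(C cd * ∏ j : Fin d, (X - C (xh j))).coeff i - c i‖ ≤
      ε * ‖c i‖ + ((1 + ε) ^ (d - i) - 1) * ‖cd‖ * esymm d (d - i) (fun j => ‖xt j‖) := by
  have hdiff : ‖(C cd * ∏ j : Fin d, (X - C (xh j))).coeff i -
      (C cd * ∏ j : Fin d, (X - C (xt j))).coeff i‖ ≤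
      ((1 + ε) ^ (d - i) - 1) * ‖cd‖ * esymm d (d - i) (fun j => ‖xt j‖) := by
    rw [coeff_C_mul_prod_X_sub_C hi.le, coeff_C_mul_prod_X_sub_C hi.le, ← mul_sub, ← mul_sub,
      norm_mul, norm_mul, norm_pow, norm_neg, norm_one, one_pow, one_mul, mul_right_comm,
      mul_comm]
    gcongr
    exact norm_esymm_sub_esymm_le d (d - i) hε h
  rw [norm_sub_rev] at hci
  exact (norm_sub_le_norm_sub_add_norm_sub _ _ _).trans
    ((add_le_add hdiff hci).trans_eq (add_comm _ _))
end

section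
/- Let d ≥ 1 and let c₀, …, c_d ∈ ℂ be nonzero with induced subdivision 0 = β₀ < β₁ < … < β_s = d. Then for each ℓ ∈ {1, …, s}, the maximum max_{0 ≤ i ≤ d} (v_i + i·τ^{(ℓ)}) is attained at both i = β_{ℓ−1} and i = β_ℓ; in particular each τ^{(ℓ)} is a root of the tropical polynomial trop f(τ) = max_{0 ≤ i ≤ d} (v_i + i·τ), i.e. the maximum defining trop f(τ^{(ℓ)}) is attained at least twice. -/
/-- Every natural number in `[β 0, β s]` lies in one of the intervals `[β m, β (m + 1)]`. -/
theorem exists_consecutive_bounds {β : ℕ → ℕ} {s i : ℕ} (hs : 1 ≤ s) (h0 : β 0 ≤ i)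
    (hi : i ≤ β s) : ∃ m < s, β m ≤ i ∧ i ≤ β (m + 1) := by
  induction s, hs using Nat.le_induction with
  | base => exact ⟨0, Nat.one_pos, h0, hi⟩
  | succ n hn ih =>
    by_cases h : i ≤ β n
    · obtain ⟨m, hm, h1, h2⟩ := ih h
      exact ⟨m, by omega, h1, h2⟩
    · exact ⟨n, Nat.lt_succ_self n, by omega, hi⟩

/-- A function increasing at each step of `[1, s]` is monotone there. -/
theorem le_of_lt_succ_on {τ : ℕ → ℝ} {s a b : ℕ}
    (hτ : ∀ ℓ, 1 ≤ ℓ → ℓ < s → τ ℓ < τ (ℓ + 1)) (ha : 1 ≤ a) (hab : a ≤ b) (hb : b ≤ s) :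
    τ a ≤ τ b := by
  induction b, hab using Nat.le_induction with
  | base => exact le_rfl
  | succ n hn ih => exact (ih (by omega)).trans (hτ n (by omega) (by omega)).le

/-- for an induced subdivision `0 = β₀ < β₁ < … < β_s = d` of the
coefficients `c₀, …, c_d` (with `v_i = log|c_i|`), each value
`τ^{(ℓ)} = (v_{β_{ℓ−1}} − v_{β_ℓ})/(β_ℓ − β_{ℓ−1})` is a tropical root: the maximum
`max_{0 ≤ i ≤ d} (v_i + i τ^{(ℓ)})` is attained at both `i = β_{ℓ−1}` and `i = β_ℓ`. -/
theorem induced_subdivision_gives_tropical_roots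
    (d s : ℕ) (hd : 1 ≤ d) (hs : 1 ≤ s)
    (c : ℕ → ℂ) (hc : ∀ i, i ≤ d → c i ≠ 0)
    (v : ℕ → ℝ) (hv : ∀ i, v i = Real.log ‖c i‖)
    (β : ℕ → ℕ) (hβ0 : β 0 = 0) (hβs : β s = d)
    (hβmono : ∀ ℓ, ℓ < s → β ℓ < β (ℓ + 1))
    (τ : ℕ → ℝ)
    (hτ : ∀ ℓ, 1 ≤ ℓ → ℓ ≤ s →
      τ ℓ = (v (β (ℓ - 1)) - v (β ℓ)) / ((β ℓ : ℝ) - (β (ℓ - 1) : ℝ)))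
    (hτmono : ∀ ℓ, 1 ≤ ℓ → ℓ < s → τ ℓ < τ (ℓ + 1))
    (hupper : ∀ ℓ i, 1 ≤ ℓ → ℓ ≤ s → β (ℓ - 1) ≤ i → i ≤ β ℓ →
      v i ≤ v (β ℓ) + ((β ℓ : ℝ) - (i : ℝ)) * τ ℓ)
    (ℓ : ℕ) (hℓ1 : 1 ≤ ℓ) (hℓs : ℓ ≤ s) :
    (∀ i, i ≤ d → v i + (i : ℝ) * τ ℓ ≤ v (β ℓ) + (β ℓ : ℝ) * τ ℓ) ∧
      v (β (ℓ - 1)) + (β (ℓ - 1) : ℝ) * τ ℓ = v (β ℓ) + (β ℓ : ℝ) * τ ℓ := by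
  obtain ⟨k, rfl⟩ : ∃ k, ℓ = k + 1 := ⟨ℓ - 1, by omega⟩
  have hβ : ∀ m, m < s → (β m : ℝ) < β (m + 1) := fun m hm => by exact_mod_cast hβmono m hm
  have hedge : ∀ m, m < s →
      v (β m) + (β m : ℝ) * τ (m + 1) = v (β (m + 1)) + (β (m + 1) : ℝ) * τ (m + 1) := by
    intro m hm
    have h := hτ (m + 1) (by omega) (by omega)
    rw [Nat.add_sub_cancel, eq_div_iff (sub_pos.2 (hβ m hm)).ne'] at h
    linarith
  have hright : ∀ n, k + 1 ≤ n → n ≤ s →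
      v (β n) + (β n : ℝ) * τ (k + 1) ≤ v (β (k + 1)) + (β (k + 1) : ℝ) * τ (k + 1) := by
    intro n hn
    induction n, hn using Nat.le_induction with
    | base => exact fun _ => le_rfl
    | succ n hn ih =>
      intro hns
      have hle : τ (k + 1) ≤ τ (n + 1) := le_of_lt_succ_on hτmono hℓ1 (by omega) hns
      nlinarith [ih (by omega), hedge n hns, hβ n hns]
  have hleft : ∀ n, n ≤ k + 1 →
      v (β n) + (β n : ℝ) * τ (k + 1) ≤ v (β (k + 1)) + (β (k + 1) : ℝ) * τ (k + 1) := by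
    intro n hn
    induction hn using Nat.decreasingInduction with
    | self => exact le_rfl
    | of_succ n hn ih =>
      have hns : n < s := by omega
      have hle : τ (n + 1) ≤ τ (k + 1) := le_of_lt_succ_on hτmono (by omega) hn hℓs
      nlinarith [ih, hedge n hns, hβ n hns]
  refine ⟨fun i hi => ?_, hedge k hℓs⟩
  obtain ⟨m, hm, h1, h2⟩ := exists_consecutive_bounds hs (hβ0 ▸ i.zero_le) (hβs ▸ hi)
  have hu := hupper (m + 1) i (by omega) hm h1 h2
  have h1' : (β m : ℝ) ≤ i := by exact_mod_cast h1
  have h2' : (i : ℝ) ≤ β (m + 1) := by exact_mod_cast h2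
  rcases le_total (m + 1) (k + 1) with hmk | hmk
  · have hle : τ (m + 1) ≤ τ (k + 1) := le_of_lt_succ_on hτmono (by omega) hmk hℓs
    nlinarith [hleft (m + 1) hmk]
  · have hle : τ (k + 1) ≤ τ (m + 1) := le_of_lt_succ_on hτmono hℓ1 hmk hm
    have hvertex : v (β m) + (β m : ℝ) * τ (k + 1) ≤
        v (β (k + 1)) + (β (k + 1) : ℝ) * τ (k + 1) := by
      rcases le_total m (k + 1) with h | h
      · exact hleft m h
      · exact hright m h hm.le
    nlinarith [hedge m hm]
end

section
/- Let d ≥ 1 and let c₀, …, c_d ∈ ℂ be nonzero with induced subdivision 0 = β₀ < β₁ < … < β_s = d and constants r_i. Then for each ℓ ∈ {1, …, s} and every i with 0 ≤ i ≤ d, r_i·|c_i|·e^{i·τ^{(ℓ)}} ≤ |c_{β_ℓ}|·e^{β_ℓ·τ^{(ℓ)}}, with equality whenever β_{ℓ−1} ≤ i ≤ β_ℓ. -/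
/-- A point below `β s` lies in one of the consecutive blocks `[β m, β (m + 1)]`. -/
theorem exists_block_of_le {α : Type*} [LinearOrder α] (β : ℕ → α) {i : α} (h0 : β 0 ≤ i) :
    ∀ {s : ℕ}, 1 ≤ s → i ≤ β s → ∃ m < s, β m ≤ i ∧ i ≤ β (m + 1) := by
  intro s
  induction s with
  | zero => intro h; omega
  | succ k ih =>
    intro _ hi
    rcases le_total (β k) i with h | h
    · exact ⟨k, k.lt_succ_self, h, hi⟩
    · rcases Nat.eq_zero_or_pos k with rfl | hk
      · exact ⟨0, Nat.one_pos, h0, hi⟩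
      · obtain ⟨m, hm, hmi⟩ := ih hk h
        exact ⟨m, hm.trans k.lt_succ_self, hmi⟩

/-- A finite sequence that increases up to index `l` and decreases afterwards is maximal at `l`. -/
theorem le_peak_of_unimodal {α : Type*} [Preorder α] {f : ℕ → α} {l s : ℕ}
    (hup : ∀ j, j < l → f j ≤ f (j + 1))
    (hdown : ∀ j, l ≤ j → j < s → f (j + 1) ≤ f j) {j : ℕ} (hj : j ≤ s) : f j ≤ f l := by
  rcases le_total j l with h | h
  · refine Nat.decreasingInduction' (P := fun k => f k ≤ f l) (fun k hk _ ih => ?_) h le_rfl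
    exact (hup k hk).trans ih
  · induction j, h using Nat.le_induction with
    | base => exact le_rfl
    | succ k hk ih => exact (hdown k hk hj).trans (ih (Nat.le_of_succ_le hj))

/-- at a point of modulus `e^{τ^{(ℓ)}}`, the terms `r_i |c_i| e^{i τ^{(ℓ)}}`
of the `r`-scaled polynomial are all dominated by the term with index `β_ℓ`, with
equality for `β_{ℓ−1} ≤ i ≤ β_ℓ` (the rigorous content behind Lemma 3.6 of the paper). -/
theorem r_scaled_terms_dominated
    (d s : ℕ) (hd : 1 ≤ d) (hs : 1 ≤ s)
    (c : ℕ → ℂ) (hc : ∀ i, i ≤ d → c i ≠ 0)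
    (v : ℕ → ℝ) (hv : ∀ i, v i = Real.log ‖c i‖)
    (β : ℕ → ℕ) (hβ0 : β 0 = 0) (hβs : β s = d)
    (hβmono : ∀ ℓ, ℓ < s → β ℓ < β (ℓ + 1))
    (τ : ℕ → ℝ)
    (hτ : ∀ ℓ, 1 ≤ ℓ → ℓ ≤ s →
      τ ℓ = (v (β (ℓ - 1)) - v (β ℓ)) / ((β ℓ : ℝ) - (β (ℓ - 1) : ℝ)))
    (hτmono : ∀ ℓ, 1 ≤ ℓ → ℓ < s → τ ℓ < τ (ℓ + 1))
    (hupper : ∀ ℓ i, 1 ≤ ℓ → ℓ ≤ s → β (ℓ - 1) ≤ i → i ≤ β ℓ →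
      v i ≤ v (β ℓ) + ((β ℓ : ℝ) - (i : ℝ)) * τ ℓ)
    (r : ℕ → ℝ)
    (hr : ∀ ℓ i, 1 ≤ ℓ → ℓ ≤ s → β (ℓ - 1) ≤ i → i ≤ β ℓ →
      r i = Real.exp (v (β ℓ) + ((β ℓ : ℝ) - (i : ℝ)) * τ ℓ - v i))
    (ℓ : ℕ) (hℓ1 : 1 ≤ ℓ) (hℓs : ℓ ≤ s) :
    (∀ i, i ≤ d →
        r i * ‖c i‖ * Real.exp ((i : ℝ) * τ ℓ) ≤
          ‖c (β ℓ)‖ * Real.exp ((β ℓ : ℝ) * τ ℓ)) ∧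
      (∀ i, β (ℓ - 1) ≤ i → i ≤ β ℓ →
        r i * ‖c i‖ * Real.exp ((i : ℝ) * τ ℓ) =
          ‖c (β ℓ)‖ * Real.exp ((β ℓ : ℝ) * τ ℓ)) := by
  have hτle : ∀ j k, 1 ≤ j → j ≤ k → k ≤ s → τ j ≤ τ k := by
    intro j k hj hjk
    induction k, hjk using Nat.le_induction with
    | base => exact fun _ => le_rfl
    | succ k hk ih => exact fun hks => (ih (by omega)).trans (hτmono k (by omega) hks).le
  have hβle : ∀ j, j ≤ s → β j ≤ d := fun j hj => by
    rw [← hβs]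
    exact Nat.decreasingInduction' (P := fun k => β k ≤ β s)
      (fun k hk _ ih => (hβmono k hk).le.trans ih) hj le_rfl
  have hexp : ∀ i, i ≤ d → ‖c i‖ = Real.exp (v i) := fun i hi => by
    rw [hv, Real.exp_log (norm_pos_iff.mpr (hc i hi))]
  have hterm : ∀ m i, m < s → β m ≤ i → i ≤ β (m + 1) →
      r i * ‖c i‖ * Real.exp ((i : ℝ) * τ ℓ) =
        Real.exp (v (β (m + 1)) + ((β (m + 1) : ℝ) - i) * τ (m + 1) + i * τ ℓ) := by
    intro m i hm h1 h2
    rw [hr (m + 1) i (by omega) hm h1 h2, hexp i (h2.trans (hβle _ hm)), ← Real.exp_add,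
      ← Real.exp_add, sub_add_cancel]
  have hpeak : ‖c (β ℓ)‖ * Real.exp ((β ℓ : ℝ) * τ ℓ) =
      Real.exp (v (β ℓ) + (β ℓ : ℝ) * τ ℓ) := by
    rw [hexp _ (hβle ℓ hℓs), ← Real.exp_add]
  have hstep : ∀ j, j < s →
      v (β j) = v (β (j + 1)) + ((β (j + 1) : ℝ) - β j) * τ (j + 1) := by
    intro j hj
    have hpos : (0 : ℝ) < (β (j + 1) : ℝ) - β j := sub_pos.mpr (by exact_mod_cast hβmono j hj)
    rw [hτ (j + 1) (by omega) hj, Nat.add_sub_cancel, mul_div_cancel₀ _ hpos.ne']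
    ring
  have hgap : ∀ j, j < s → (β j : ℝ) ≤ β (j + 1) := fun j hj => by
    exact_mod_cast (hβmono j hj).le
  have hvertex : ∀ j, j ≤ s → v (β j) + (β j : ℝ) * τ ℓ ≤ v (β ℓ) + (β ℓ : ℝ) * τ ℓ := by
    intro j hj
    refine le_peak_of_unimodal (f := fun k => v (β k) + (β k : ℝ) * τ ℓ)
      (fun k hk => ?_) (fun k hk hks => ?_) hj
    · have hks : k < s := by omega
      nlinarith [hstep k hks, hgap k hks, hτle (k + 1) ℓ (by omega) hk hℓs]
    · nlinarith [hstep k hks, hgap k hks, hτle ℓ (k + 1) hℓ1 (by omega) hks]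
  refine ⟨fun i hi => ?_, fun i h1 h2 => ?_⟩
  · obtain ⟨m, hm, h1, h2⟩ := exists_block_of_le β (by omega : β 0 ≤ i) hs (hβs ▸ hi)
    rw [hterm m i hm h1 h2, hpeak, Real.exp_le_exp]
    have h1' : (β m : ℝ) ≤ i := by exact_mod_cast h1
    have h2' : (i : ℝ) ≤ β (m + 1) := by exact_mod_cast h2
    rcases Nat.lt_or_ge m ℓ with h | h
    · nlinarith [hvertex (m + 1) hm, hτle (m + 1) ℓ (by omega) h hℓs]
    · nlinarith [hvertex m hm.le, hstep m hm, hτle ℓ (m + 1) hℓ1 (by omega) hm]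
  · obtain ⟨m, rfl⟩ := Nat.exists_eq_add_of_le' hℓ1
    rw [hterm m i hℓs h1 h2, hpeak]
    ring_nf
end

section
/- Let d ≥ 1, let c₀, …, c_d ∈ ℂ be nonzero with induced subdivision 0 = β₀ < β₁ < … < β_s = d, tropical roots τ₁, …, τ_d, and constants r_i. Let ε ≥ 0 and let x̃, x̂ ∈ (ℂ \ {0})^d satisfy |x̂_j − x̃_j| ≤ ε|x̃_j| for all j, and let c̃_i, ĉ_i be the degree-i coefficients of c_d·∏_{j=1}^d (X − x̃_j) and c_d·∏_{j=1}^d (X − x̂_j). Assume that for every i ∈ {0, …, d−1} there is W_i ≥ 0 with |c_i − c̃_i| ≤ ε|c_i| and σ_{d−i}(|x̃₁|, …, |x̃_d|) ≤ W_i·∏_{k=i+1}^{d} e^{τ_k}. Then, writing c = (c₀, …, c_d) and ĉ = (ĉ₀, …, ĉ_{d−1}, c_d), one has ‖c − ĉ‖₂ ≤ √d · max_{0 ≤ i ≤ d−1} (ε + ((1 + ε)^{d−i} − 1)·W_i) · ‖c‖₂. -/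
open Polynomial

/-- A relative perturbation of size `ε` of each factor perturbs a product of `n` factors by at
most `(1 + ε) ^ n - 1` in relative terms. -/
theorem norm_prod_sub_prod_le_of_rel {ι : Type*} (s : Finset ι) (x y : ι → ℂ) {ε : ℝ}
    (hε : 0 ≤ ε) (h : ∀ j ∈ s, ‖y j - x j‖ ≤ ε * ‖x j‖) :
    ‖∏ j ∈ s, y j - ∏ j ∈ s, x j‖ ≤ ((1 + ε) ^ s.card - 1) * ∏ j ∈ s, ‖x j‖ := by
  classical
  induction s using Finset.induction_on with
  | empty => simp
  | insert a s ha ih =>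
    have ih' := ih fun j hj => h j (Finset.mem_insert_of_mem hj)
    have h1 := h a (Finset.mem_insert_self a s)
    rw [Finset.prod_insert ha, Finset.prod_insert ha, Finset.prod_insert ha,
      Finset.card_insert_of_notMem ha]
    have hy : ‖y a‖ ≤ (1 + ε) * ‖x a‖ := by
      linarith [norm_le_norm_add_norm_sub (x a) (y a), norm_sub_rev (x a) (y a)]
    calc ‖y a * ∏ j ∈ s, y j - x a * ∏ j ∈ s, x j‖
        = ‖(y a - x a) * ∏ j ∈ s, x j + y a * (∏ j ∈ s, y j - ∏ j ∈ s, x j)‖ := by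
          congr 1; ring
      _ ≤ ‖y a - x a‖ * ∏ j ∈ s, ‖x j‖ + ‖y a‖ * ‖∏ j ∈ s, y j - ∏ j ∈ s, x j‖ := by
          refine (norm_add_le _ _).trans (le_of_eq ?_)
          rw [norm_mul, norm_mul, norm_prod]
      _ ≤ ε * ‖x a‖ * ∏ j ∈ s, ‖x j‖ +
            (1 + ε) * ‖x a‖ * (((1 + ε) ^ s.card - 1) * ∏ j ∈ s, ‖x j‖) := by
          gcongr
      _ = ((1 + ε) ^ (s.card + 1) - 1) * (‖x a‖ * ∏ j ∈ s, ‖x j‖) := by ring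

/-- Vieta's formula for `esymm`. -/
theorem coeff_prod_X_sub_C_eq_esymm (d i : ℕ) (hi : i ≤ d) (x : Fin d → ℂ) :
    (∏ j : Fin d, (X - C (x j))).coeff i = (-1) ^ (d - i) * esymm d (d - i) x := by
  have h := Multiset.prod_X_sub_C_coeff ((Finset.univ : Finset (Fin d)).val.map x) (k := i)
    (by simpa using hi)
  rw [Finset.esymm_map_val, Multiset.map_map] at h
  rw [Finset.prod_eq_multiset_prod]
  simpa only [Multiset.card_map, Finset.card_val, Finset.card_univ, Fintype.card_fin,
    Function.comp_def, esymm] using h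

/-- Elementary symmetric polynomials under relative perturbations of the variables. -/
theorem norm_esymm_sub_esymm_le_of_rel (d k : ℕ) (x y : Fin d → ℂ) {ε : ℝ}
    (hε : 0 ≤ ε) (h : ∀ j, ‖y j - x j‖ ≤ ε * ‖x j‖) :
    ‖esymm d k x - esymm d k y‖ ≤ ((1 + ε) ^ k - 1) * esymm d k (fun j => ‖x j‖) := by
  rw [norm_sub_rev]
  unfold esymm
  rw [← Finset.sum_sub_distrib, Finset.mul_sum]
  refine norm_sum_le_of_le _ fun I hI => ?_
  have := norm_prod_sub_prod_le_of_rel I x y hε fun j _ => h j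
  rwa [(Finset.mem_powersetCard.mp hI).2] at this

/-- Coefficients of `C a * ∏ (X - C (x j))` under relative perturbations of the roots. -/
theorem norm_coeff_sub_coeff_le_of_rel (d i : ℕ) (hi : i ≤ d) (a : ℂ) (x y : Fin d → ℂ) {ε : ℝ}
    (hε : 0 ≤ ε) (h : ∀ j, ‖y j - x j‖ ≤ ε * ‖x j‖) :
    ‖(C a * ∏ j : Fin d, (X - C (x j))).coeff i - (C a * ∏ j : Fin d, (X - C (y j))).coeff i‖ ≤
      ‖a‖ * (((1 + ε) ^ (d - i) - 1) * esymm d (d - i) (fun j => ‖x j‖)) := by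
  rw [coeff_C_mul, coeff_C_mul, coeff_prod_X_sub_C_eq_esymm d i hi,
    coeff_prod_X_sub_C_eq_esymm d i hi, ← mul_sub, ← mul_sub, norm_mul, norm_mul, norm_pow,
    norm_neg, norm_one, one_pow, one_mul]
  gcongr
  exact norm_esymm_sub_esymm_le_of_rel d (d - i) x y hε h

/-- Every index below the last breakpoint lies in some block of the subdivision. -/
theorem exists_block_of_lt (β : ℕ → ℕ) (hβ0 : β 0 = 0) (i m : ℕ) (hi : i < β m) :
    ∃ ℓ, 1 ≤ ℓ ∧ ℓ ≤ m ∧ β (ℓ - 1) ≤ i ∧ i < β ℓ := by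
  induction m with
  | zero => omega
  | succ m ih =>
    by_cases him : i < β m
    · obtain ⟨ℓ, h1, h2, h3⟩ := ih him
      exact ⟨ℓ, h1, by omega, h3⟩
    · exact ⟨m + 1, by omega, le_rfl, by simpa using not_lt.mp him, hi⟩

/-- The sum of slopes beyond a breakpoint telescopes. -/
theorem add_sum_slopes_eq_of_breakpoint (d s : ℕ) (v : ℕ → ℝ) (β : ℕ → ℕ) (hβs : β s = d)
    (hβmono : ∀ ℓ, ℓ < s → β ℓ < β (ℓ + 1)) (τ : ℕ → ℝ)
    (hτ : ∀ ℓ, 1 ≤ ℓ → ℓ ≤ s →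
      τ ℓ = (v (β (ℓ - 1)) - v (β ℓ)) / ((β ℓ : ℝ) - (β (ℓ - 1) : ℝ)))
    (τr : ℕ → ℝ)
    (hτr : ∀ ℓ k, 1 ≤ ℓ → ℓ ≤ s → β (ℓ - 1) < k → k ≤ β ℓ → τr k = τ ℓ)
    (ℓ : ℕ) (hℓ : ℓ ≤ s) :
    β ℓ ≤ d ∧ v d + ∑ k ∈ Finset.Ioc (β ℓ) d, τr k = v (β ℓ) := by
  induction hℓ using Nat.decreasingInduction with
  | self => simp [hβs]
  | of_succ m hm ih =>
    obtain ⟨hle, hsum⟩ := ih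
    have hlt := hβmono m hm
    refine ⟨hlt.le.trans hle, ?_⟩
    have hblock : ∑ k ∈ Finset.Ioc (β m) (β (m + 1)), τr k =
        ((β (m + 1) : ℝ) - β m) * τ (m + 1) := by
      rw [Finset.sum_congr rfl fun k hk => hτr (m + 1) k (by omega) hm
        (by simpa using (Finset.mem_Ioc.mp hk).1) (Finset.mem_Ioc.mp hk).2]
      simp [Nat.cast_sub hlt.le]
    have hpos : (0 : ℝ) < (β (m + 1) : ℝ) - β m := sub_pos.mpr (by exact_mod_cast hlt)
    have hslope := hτ (m + 1) (by omega) hm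
    rw [Nat.add_sub_cancel, eq_div_iff hpos.ne'] at hslope
    rw [← Finset.sum_Ioc_consecutive _ hlt.le hle, hblock]
    linarith

/-- The piecewise affine function with the given slopes is bounded at each index by the value
of `v` at some breakpoint. -/
theorem exists_add_sum_slopes_le (d s : ℕ) (v : ℕ → ℝ) (β : ℕ → ℕ) (hβ0 : β 0 = 0)
    (hβs : β s = d) (hβmono : ∀ ℓ, ℓ < s → β ℓ < β (ℓ + 1)) (τ : ℕ → ℝ)
    (hτ : ∀ ℓ, 1 ≤ ℓ → ℓ ≤ s →
      τ ℓ = (v (β (ℓ - 1)) - v (β ℓ)) / ((β ℓ : ℝ) - (β (ℓ - 1) : ℝ)))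
    (τr : ℕ → ℝ)
    (hτr : ∀ ℓ k, 1 ≤ ℓ → ℓ ≤ s → β (ℓ - 1) < k → k ≤ β ℓ → τr k = τ ℓ)
    (i : ℕ) (hi : i < d) :
    ∃ b ≤ d, v d + ∑ k ∈ Finset.Ioc i d, τr k ≤ v b := by
  obtain ⟨ℓ, h1, hs, hlo, hhi⟩ := exists_block_of_lt β hβ0 i s (hβs.symm ▸ hi)
  have key := add_sum_slopes_eq_of_breakpoint d s v β hβs hβmono τ hτ τr hτr
  obtain ⟨hle, hsum⟩ := key ℓ hs
  obtain ⟨hle', -⟩ := key (ℓ - 1) (by omega)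
  have hblock : ∑ k ∈ Finset.Ioc i (β ℓ), τr k = ((β ℓ : ℝ) - i) * τ ℓ := by
    rw [Finset.sum_congr rfl fun k hk => hτr ℓ k h1 hs
      (hlo.trans_lt (Finset.mem_Ioc.mp hk).1) (Finset.mem_Ioc.mp hk).2]
    simp [Nat.cast_sub hhi.le]
  have hlo' : (β (ℓ - 1) : ℝ) ≤ i := by exact_mod_cast hlo
  have hhi' : (i : ℝ) < β ℓ := by exact_mod_cast hhi
  have hslope := hτ ℓ h1 hs
  rw [eq_div_iff (by linarith)] at hslope
  rw [← Finset.sum_Ioc_consecutive _ hhi.le hle, hblock]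
  rcases le_total (τ ℓ) 0 with hneg | hpos
  · exact ⟨β ℓ, hle, by nlinarith⟩
  · exact ⟨β (ℓ - 1), hle', by nlinarith⟩

/-- precise form of Proposition 3.4 of the paper (element-wise mixed
backward error `ε` implies norm-wise backward error `O(ε)`).  Here
`ĉ_i = (C c_d ∏ (X − x̂_j)).coeff i` for `i < d` and `ĉ_d = c_d` (which is also the
degree-`d` coefficient of that product), so `‖c − ĉ‖₂` is the square root of the sum of
the squared coefficient errors. -/
theorem EMBE_implies_NBE
    (d s : ℕ) (hd : 1 ≤ d) (hs : 1 ≤ s)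
    (c : ℕ → ℂ) (hc : ∀ i, i ≤ d → c i ≠ 0)
    (v : ℕ → ℝ) (hv : ∀ i, v i = Real.log ‖c i‖)
    (β : ℕ → ℕ) (hβ0 : β 0 = 0) (hβs : β s = d)
    (hβmono : ∀ ℓ, ℓ < s → β ℓ < β (ℓ + 1))
    (τ : ℕ → ℝ)
    (hτ : ∀ ℓ, 1 ≤ ℓ → ℓ ≤ s →
      τ ℓ = (v (β (ℓ - 1)) - v (β ℓ)) / ((β ℓ : ℝ) - (β (ℓ - 1) : ℝ)))
    (hτmono : ∀ ℓ, 1 ≤ ℓ → ℓ < s → τ ℓ < τ (ℓ + 1))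
    (hupper : ∀ ℓ i, 1 ≤ ℓ → ℓ ≤ s → β (ℓ - 1) ≤ i → i ≤ β ℓ →
      v i ≤ v (β ℓ) + ((β ℓ : ℝ) - (i : ℝ)) * τ ℓ)
    (r : ℕ → ℝ)
    (hr : ∀ ℓ i, 1 ≤ ℓ → ℓ ≤ s → β (ℓ - 1) ≤ i → i ≤ β ℓ →
      r i = Real.exp (v (β ℓ) + ((β ℓ : ℝ) - (i : ℝ)) * τ ℓ - v i))
    (τr : ℕ → ℝ)
    (hτr : ∀ ℓ k, 1 ≤ ℓ → ℓ ≤ s → β (ℓ - 1) < k → k ≤ β ℓ → τr k = τ ℓ)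
    (ε : ℝ) (hε : 0 ≤ ε)
    (xt xh : Fin d → ℂ)
    (hxt : ∀ j, xt j ≠ 0) (hxh : ∀ j, xh j ≠ 0)
    (h : ∀ j, ‖xh j - xt j‖ ≤ ε * ‖xt j‖)
    (W : ℕ → ℝ) (hW : ∀ i, i < d → 0 ≤ W i)
    (hci : ∀ i, i < d →
      ‖c i - (C (c d) * ∏ j : Fin d, (X - C (xt j))).coeff i‖ ≤ ε * ‖c i‖)
    (hσ : ∀ i, i < d →
      esymm d (d - i) (fun j => ‖xt j‖) ≤
        W i * ∏ k ∈ Finset.Icc (i + 1) d, Real.exp (τr k)) :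
    Real.sqrt (∑ i ∈ Finset.range (d + 1),
        ‖c i - (C (c d) * ∏ j : Fin d, (X - C (xh j))).coeff i‖ ^ 2) ≤
      Real.sqrt d *
        ((Finset.range d).sup' ⟨0, Finset.mem_range.mpr hd⟩
          (fun i => ε + ((1 + ε) ^ (d - i) - 1) * W i)) *
        Real.sqrt (∑ i ∈ Finset.range (d + 1), ‖c i‖ ^ 2) := by
  set N := Real.sqrt (∑ i ∈ Finset.range (d + 1), ‖c i‖ ^ 2)
  set M := (Finset.range d).sup' ⟨0, Finset.mem_range.mpr hd⟩
    (fun i => ε + ((1 + ε) ^ (d - i) - 1) * W i)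
  have hcN : ∀ i, i ≤ d → ‖c i‖ ≤ N := fun i hi =>
    Real.le_sqrt_of_sq_le (Finset.single_le_sum (f := fun i => ‖c i‖ ^ 2)
      (fun _ _ => by positivity) (Finset.mem_range.mpr (Nat.lt_succ_of_le hi)))
  have hN0 : 0 ≤ N := Real.sqrt_nonneg _
  have hexp : ∀ i, i ≤ d → Real.exp (v i) = ‖c i‖ := fun i hi => by
    rw [hv, Real.exp_log (norm_pos_iff.mpr (hc i hi))]
  have hpow : ∀ n : ℕ, 0 ≤ (1 + ε) ^ n - 1 := fun n =>
    sub_nonneg.mpr (one_le_pow₀ (by linarith))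
  have hlow : ∀ i, i < d →
      ‖c i - (C (c d) * ∏ j : Fin d, (X - C (xh j))).coeff i‖ ≤ M * N := by
    intro i hi
    have hprod : ‖c d‖ * ∏ k ∈ Finset.Icc (i + 1) d, Real.exp (τr k) ≤ N := by
      obtain ⟨b, hb, hvb⟩ :=
        exists_add_sum_slopes_le d s v β hβ0 hβs hβmono τ hτ τr hτr i hi
      have hIcc : Finset.Icc (i + 1) d = Finset.Ioc i d := by ext; simp
      rw [hIcc, ← Real.exp_sum, ← hexp d le_rfl, ← Real.exp_add]
      exact (Real.exp_le_exp.mpr hvb).trans ((hexp b hb).trans_le (hcN b hb))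
    calc ‖c i - (C (c d) * ∏ j : Fin d, (X - C (xh j))).coeff i‖
        ≤ ‖c i - (C (c d) * ∏ j : Fin d, (X - C (xt j))).coeff i‖ +
          ‖(C (c d) * ∏ j : Fin d, (X - C (xt j))).coeff i -
            (C (c d) * ∏ j : Fin d, (X - C (xh j))).coeff i‖ :=
        norm_sub_le_norm_sub_add_norm_sub _ _ _
      _ ≤ ε * ‖c i‖ +
          ‖c d‖ * (((1 + ε) ^ (d - i) - 1) * esymm d (d - i) (fun j => ‖xt j‖)) :=
        add_le_add (hci i hi) (norm_coeff_sub_coeff_le_of_rel d i hi.le _ xt xh hε h)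
      _ ≤ ε * N + ‖c d‖ * (((1 + ε) ^ (d - i) - 1) *
            (W i * ∏ k ∈ Finset.Icc (i + 1) d, Real.exp (τr k))) := by
        have := hpow (d - i)
        gcongr
        · exact hcN i hi.le
        · exact hσ i hi
      _ = ε * N + ((1 + ε) ^ (d - i) - 1) * W i *
            (‖c d‖ * ∏ k ∈ Finset.Icc (i + 1) d, Real.exp (τr k)) := by ring
      _ ≤ ε * N + ((1 + ε) ^ (d - i) - 1) * W i * N := by
        have := mul_nonneg (hpow (d - i)) (hW i hi)
        gcongr
      _ = (ε + ((1 + ε) ^ (d - i) - 1) * W i) * N := by ring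
      _ ≤ M * N := by
        gcongr
        exact Finset.le_sup' (fun i => ε + ((1 + ε) ^ (d - i) - 1) * W i)
          (Finset.mem_range.mpr hi)
  have htop : (C (c d) * ∏ j : Fin d, (X - C (xh j))).coeff d = c d := by
    rw [coeff_C_mul, coeff_prod_X_sub_C_eq_esymm d d le_rfl]
    simp [esymm]
  have hMN : 0 ≤ M * N := (norm_nonneg _).trans (hlow 0 hd)
  rw [mul_assoc, Finset.sum_range_succ, htop, sub_self, norm_zero]
  refine Real.sqrt_le_iff.mpr ⟨by positivity, ?_⟩
  rw [mul_pow, Real.sq_sqrt (Nat.cast_nonneg d)]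
  have hsum := Finset.sum_le_card_nsmul (Finset.range d)
    (fun i => ‖c i - (C (c d) * ∏ j : Fin d, (X - C (xh j))).coeff i‖ ^ 2) ((M * N) ^ 2)
    fun i hi => pow_le_pow_left₀ (norm_nonneg _) (hlow i (Finset.mem_range.mp hi)) 2
  simpa using hsum
end

section
/- Let d ≥ 1, let f = Σ_{i=0}^{d} c_i x^i ∈ ℂ[x] with c_d ≠ 0, and let x* ∈ ℂ \ {0} with f(x*) = 0. Let β', β ∈ {0, …, d} with β' < β, and let η ≥ 0 satisfy Σ_{i ∈ {0,…,d}, i ∉ {β', β}} |c_i|·|x*|^i ≤ η·|c_β|·|x*|^β. Then |x*·f'(x*) − (β − β')·c_β·(x*)^β| ≤ 2dη·|c_β|·|x*|^β; in particular, if 2dη < β − β' then |x*·f'(x*)| ≥ (β − β' − 2dη)·|c_β|·|x*|^β > 0. -/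
open Polynomial

/-- A sum over `range (d + 1)` splits off the terms at two distinct indices. -/
lemma sum_range_eq_add_add_sum_sdiff_pair {M : Type*} [AddCommMonoid M] (g : ℕ → M)
    {d a b : ℕ} (hab : a < b) (hb : b ≤ d) :
    ∑ i ∈ Finset.range (d + 1), g i =
      g a + g b + ∑ i ∈ Finset.range (d + 1) \ {a, b}, g i := by
  have hsub : ({a, b} : Finset ℕ) ⊆ Finset.range (d + 1) := by
    intro i hi
    simp only [Finset.mem_insert, Finset.mem_singleton] at hi
    simp only [Finset.mem_range]
    omega
  rw [← Finset.sum_sdiff hsub, Finset.sum_pair hab.ne, add_comm]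

/-- The Euler operator `x * d/dx` multiplies the `i`-th monomial by `i`. -/
lemma mul_eval_derivative_sum (s : Finset ℕ) (c : ℕ → ℂ) (x : ℂ) :
    x * (derivative (∑ i ∈ s, C (c i) * X ^ i)).eval x = ∑ i ∈ s, (i : ℂ) * (c i * x ^ i) := by
  rw [derivative_sum, eval_finsetSum, Finset.mul_sum]
  refine Finset.sum_congr rfl fun i _ => ?_
  rcases i with _ | n
  · simp
  · simp only [derivative_C_mul_X_pow, eval_mul, eval_C, eval_pow, eval_X, Nat.add_sub_cancel]
    ring

/-- quantitative `k = 1` case of Lemma 3.5 of the paper.  If at a nonzero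
root `x*` of `f = Σ c_i x^i` the two terms with indices `β' < β` dominate all the other
terms (with ratio `η`), then `x* f'(x*)` is within `2 d η |c_β| |x*|^β` of
`(β − β') c_β (x*)^β`; in particular it is bounded below when `2 d η < β − β'`. -/
theorem root_well_conditioned_first_derivative
    (d : ℕ) (hd : 1 ≤ d) (c : ℕ → ℂ) (hcd : c d ≠ 0)
    (f : Polynomial ℂ)
    (hf : f = ∑ i ∈ Finset.range (d + 1), C (c i) * X ^ i)
    (x : ℂ) (hx : x ≠ 0) (hroot : f.eval x = 0)
    (β' β : ℕ) (hβ'β : β' < β) (hβd : β ≤ d)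
    (η : ℝ) (hη : 0 ≤ η)
    (hdom : ∑ i ∈ Finset.range (d + 1) \ {β', β}, ‖c i‖ * ‖x‖ ^ i ≤
      η * (‖c β‖ * ‖x‖ ^ β)) :
    ‖x * f.derivative.eval x - ((β : ℂ) - (β' : ℂ)) * c β * x ^ β‖ ≤
        2 * d * η * (‖c β‖ * ‖x‖ ^ β) ∧
      (2 * d * η < (β : ℝ) - (β' : ℝ) →
        ((β : ℝ) - (β' : ℝ) - 2 * d * η) * (‖c β‖ * ‖x‖ ^ β) ≤
            ‖x * f.derivative.eval x‖ ∧
          0 < ‖x * f.derivative.eval x‖) := by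
  have hsum : ∑ i ∈ Finset.range (d + 1), c i * x ^ i = 0 := by
    simpa [hf, eval_finsetSum] using hroot
  have key : x * f.derivative.eval x - ((β : ℂ) - (β' : ℂ)) * c β * x ^ β =
      ∑ i ∈ Finset.range (d + 1) \ {β', β}, ((i : ℂ) - β') * (c i * x ^ i) := by
    have h : x * f.derivative.eval x =
        ∑ i ∈ Finset.range (d + 1), ((i : ℂ) - β') * (c i * x ^ i) := by
      simp_rw [sub_mul, Finset.sum_sub_distrib, ← Finset.mul_sum, hsum]
      rw [hf, mul_eval_derivative_sum, mul_zero, sub_zero]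
    rw [h, sum_range_eq_add_add_sum_sdiff_pair _ hβ'β hβd]
    ring
  set B := ‖c β‖ * ‖x‖ ^ β with hB
  have hB0 : 0 ≤ B := by positivity
  have hbound : ‖x * f.derivative.eval x - ((β : ℂ) - (β' : ℂ)) * c β * x ^ β‖ ≤
      2 * d * η * B := by
    rw [key]
    calc _ ≤ ∑ i ∈ Finset.range (d + 1) \ {β', β}, (d : ℝ) * (‖c i‖ * ‖x‖ ^ i) := by
          refine norm_sum_le_of_le _ fun i hi => ?_
          rw [norm_mul, norm_mul, norm_pow]
          gcongr
          have hid : i ≤ d := by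
            have := (Finset.mem_sdiff.mp hi).1
            simp only [Finset.mem_range] at this
            omega
          have hcast : ((i : ℂ) - β') = (((i : ℝ) - β' : ℝ) : ℂ) := by push_cast; rfl
          rw [hcast, Complex.norm_real, Real.norm_eq_abs, abs_le]
          have h1 : (i : ℝ) ≤ d := by exact_mod_cast hid
          have h2 : (β' : ℝ) ≤ d := by exact_mod_cast hβ'β.le.trans hβd
          constructor <;> linarith [i.cast_nonneg (α := ℝ), β'.cast_nonneg (α := ℝ)]
      _ ≤ d * (η * B) := by
          rw [← Finset.mul_sum]
          gcongr
      _ ≤ 2 * d * η * B := by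
          have : 0 ≤ d * (η * B) := by positivity
          linarith
  refine ⟨hbound, fun hη' => ?_⟩
  have hmain : ‖((β : ℂ) - (β' : ℂ)) * c β * x ^ β‖ = ((β : ℝ) - β') * B := by
    have hcast : ((β : ℂ) - β') = (((β : ℝ) - β' : ℝ) : ℂ) := by push_cast; rfl
    have hlt : (β' : ℝ) < β := by exact_mod_cast hβ'β
    rw [mul_assoc, norm_mul, norm_mul, norm_pow, hcast, Complex.norm_real, Real.norm_eq_abs,
      abs_of_pos (sub_pos.mpr hlt)]
  have hlower : ((β : ℝ) - (β' : ℝ) - 2 * d * η) * B ≤ ‖x * f.derivative.eval x‖ := by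
    have htri := norm_sub_norm_le (((β : ℂ) - (β' : ℂ)) * c β * x ^ β) (x * f.derivative.eval x)
    rw [norm_sub_rev, hmain] at htri
    linarith
  have hcβ : c β ≠ 0 := by
    intro h0
    have hrest : ∀ i ∈ Finset.range (d + 1) \ {β', β}, c i = 0 := by
      have hle : ∑ i ∈ Finset.range (d + 1) \ {β', β}, ‖c i‖ * ‖x‖ ^ i ≤ 0 := by
        simpa [hB, h0] using hdom
      intro i hi
      have hi0 := (Finset.sum_eq_zero_iff_of_nonneg fun j _ => by positivity).mp
        (hle.antisymm (Finset.sum_nonneg fun j _ => by positivity)) i hi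
      simpa [hx] using hi0
    have hcβ' : c β' = 0 := by
      rw [sum_range_eq_add_add_sum_sdiff_pair _ hβ'β hβd,
        Finset.sum_eq_zero fun i hi => by rw [hrest i hi, zero_mul], h0] at hsum
      simpa [hx] using hsum
    by_cases hdβ : d = β
    · exact hcd (hdβ ▸ h0)
    · exact hcd (hrest d (by simp; omega))
  exact ⟨hlower, (mul_pos (sub_pos.mpr hη') (by positivity)).trans_le hlower⟩
end

section
/- Let d ≥ 1, let f = Σ_{i=0}^{d} c_i x^i ∈ ℂ[x] with c_d ≠ 0, and let x* ∈ ℂ \ {0} with f(x*) = 0. Let β', β ∈ {0, …, d} with β' < β, and let η ≥ 0 satisfy Σ_{i ∈ {0,…,d}, i ∉ {β', β}} |c_i|·|x*|^i ≤ η·|c_β|·|x*|^β. Then for every k with 1 ≤ k ≤ d, |(x*)^k · f^{(k)}(x*)| ≤ (1 + 2η)·(d!/(d−k)!)·|c_β|·|x*|^β. -/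
open Polynomial

/-- The `k`-th derivative of `Σ c_i X^i` at `x`, scaled by `x^k`, weights the term `c_i x^i` by the
falling factorial `i.descFactorial k`. -/
theorem pow_mul_eval_iterate_derivative_sum {R : Type*} [CommRing R] (s : Finset ℕ) (c : ℕ → R)
    (x : R) (k : ℕ) :
    x ^ k * ((Polynomial.derivative)^[k] (∑ i ∈ s, C (c i) * X ^ i)).eval x =
      ∑ i ∈ s, (i.descFactorial k : R) * (c i * x ^ i) := by
  rw [iterate_derivative_sum, eval_finsetSum, Finset.mul_sum]
  refine Finset.sum_congr rfl fun i _ => ?_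
  rw [iterate_derivative_C_mul, iterate_derivative_X_pow_eq_natCast_mul]
  simp only [eval_mul, eval_C, eval_natCast, eval_pow, eval_X]
  rcases le_or_gt k i with h | h
  · rw [← Nat.sub_add_cancel h, pow_add, Nat.add_sub_cancel]
    ring
  · simp [Nat.descFactorial_of_lt h]

/-- If complex numbers `a i` sum to zero, a sum weighted by reals in `[0, D]` is controlled
by `D` times the norms of all the terms but one. -/
theorem norm_sum_mul_le_of_sum_eq_zero {ι : Type*} [DecidableEq ι] (s : Finset ι) (a : ι → ℂ)
    (w : ι → ℝ) (D : ℝ) (hw : ∀ i ∈ s, w i ∈ Set.Icc 0 D) (ha : ∑ i ∈ s, a i = 0)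
    {j : ι} (hj : j ∈ s) :
    ‖∑ i ∈ s, (w i : ℂ) * a i‖ ≤ D * ∑ i ∈ s.erase j, ‖a i‖ := by
  have hsum : ∑ i ∈ s, (w i : ℂ) * a i = ∑ i ∈ s.erase j, ((w i - w j : ℝ) : ℂ) * a i := by
    rw [Finset.sum_erase _ (by simp)]
    simp only [Complex.ofReal_sub, sub_mul, Finset.sum_sub_distrib, ← Finset.mul_sum, ha,
      mul_zero, sub_zero]
  rw [hsum, Finset.mul_sum]
  refine norm_sum_le_of_le _ fun i hi => ?_
  have hi' := hw i (Finset.mem_of_mem_erase hi)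
  have hj' := hw j hj
  rw [norm_mul, Complex.norm_real, Real.norm_eq_abs]
  gcongr
  exact abs_sub_le_iff.2 ⟨by linarith [hi'.2, hj'.1], by linarith [hi'.1, hj'.2]⟩

/-- quantitative form of Lemma 3.5 of the paper.  If at a nonzero root `x*`
of `f = Σ c_i x^i` the two terms with indices `β' < β` dominate all other terms (with
ratio `η`), then for `1 ≤ k ≤ d` the scaled `k`-th derivative satisfies
`|(x*)^k f^{(k)}(x*)| ≤ (1 + 2η) (d!/(d−k)!) |c_β| |x*|^β`. -/
theorem root_scaled_higher_derivatives_bound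
    (d : ℕ) (hd : 1 ≤ d) (c : ℕ → ℂ) (hcd : c d ≠ 0)
    (f : Polynomial ℂ)
    (hf : f = ∑ i ∈ Finset.range (d + 1), C (c i) * X ^ i)
    (x : ℂ) (hx : x ≠ 0) (hroot : f.eval x = 0)
    (β' β : ℕ) (hβ'β : β' < β) (hβd : β ≤ d)
    (η : ℝ) (hη : 0 ≤ η)
    (hdom : ∑ i ∈ Finset.range (d + 1) \ {β', β}, ‖c i‖ * ‖x‖ ^ i ≤
      η * (‖c β‖ * ‖x‖ ^ β))
    (k : ℕ) (hk1 : 1 ≤ k) (hkd : k ≤ d) :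
    ‖x ^ k * ((Polynomial.derivative)^[k] f).eval x‖ ≤
      (1 + 2 * η) * ((d.factorial : ℝ) / ((d - k).factorial : ℝ)) *
        (‖c β‖ * ‖x‖ ^ β) := by
  have hD : (d.factorial : ℝ) / ((d - k).factorial : ℝ) = d.descFactorial k := by
    rw [Nat.descFactorial_eq_div hkd, Nat.cast_div (Nat.factorial_dvd_factorial (Nat.sub_le d k))
      (by positivity)]
  have hzero : ∑ i ∈ Finset.range (d + 1), c i * x ^ i = 0 := by
    simpa [hf, eval_finsetSum] using hroot
  have hbound := norm_sum_mul_le_of_sum_eq_zero (Finset.range (d + 1)) (fun i => c i * x ^ i)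
    (fun i => (i.descFactorial k : ℝ)) (d.descFactorial k)
    (fun i hi => ⟨by positivity, by
      exact_mod_cast Nat.descFactorial_le k (Finset.mem_range_succ_iff.1 hi)⟩)
    hzero (j := β') (Finset.mem_range.2 (by omega))
  have hβ : β ∈ (Finset.range (d + 1)).erase β' := by
    simp only [Finset.mem_erase, Finset.mem_range]
    omega
  have herase : ((Finset.range (d + 1)).erase β').erase β =
      Finset.range (d + 1) \ {β', β} := by
    ext i
    simp only [Finset.mem_erase, Finset.mem_sdiff, Finset.mem_insert, Finset.mem_singleton]
    tauto
  rw [← Finset.add_sum_erase _ _ hβ, herase] at hbound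
  simp only [norm_mul, norm_pow, Complex.ofReal_natCast] at hbound
  rw [hD, hf, pow_mul_eval_iterate_derivative_sum]
  calc _ ≤ _ := hbound
    _ ≤ (d.descFactorial k : ℝ) * ((1 + 2 * η) * (‖c β‖ * ‖x‖ ^ β)) := by
      gcongr
      have : 0 ≤ η * (‖c β‖ * ‖x‖ ^ β) := by positivity
      linarith
    _ = _ := by ring
end
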